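/- cof(M) = max{d, non(M)}. -/

import Mathlib

open Cardinal

/-- `cof(M)`: the least cardinality of a family `B` of meager subsets of the real
line such that every meager set is contained in a member of `B`. -/
noncomputable def cofMeager : Cardinal :=
  sInf {c | ∃ 𝒜 : Set (Set ℝ), (∀ A ∈ 𝒜, IsMeagre A) ∧
    (∀ B : Set ℝ, IsMeagre B → ∃ A ∈ 𝒜, B ⊆ A) ∧ #𝒜 = c}

/-- `non(M)`: the least cardinality of a non-meager subset of the real line. -/
noncomputable def nonMeager : Cardinal :=
  sInf {c | ∃ A : Set ℝ, ¬ IsMeagre A ∧ #A = c}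

/-- `𝔡`: the least cardinality of a dominating family in `(ω^ω, ≤*)`. -/
noncomputable def dominatingNumber : Cardinal :=
  sInf {c | ∃ D : Set (ℕ → ℕ), #D = c ∧
    ∀ f : ℕ → ℕ, ∃ g ∈ D, ∀ᶠ n in Filter.atTop, f n ≤ g n}

open Filter Set

/-- The `k`-th digit of `y` after the ternary point. -/
noncomputable def ternaryDigit (y : ℝ) (k : ℕ) : ℤ := ⌊3 ^ (k + 1) * y⌋ - 3 * ⌊3 ^ k * y⌋

/-- The ternary digits of `y` and `z` with indices in `[n, m)` coincide. -/
def DigitsAgree (y z : ℝ) (n m : ℕ) : Prop :=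
  ∀ k, n ≤ k → k < m → ternaryDigit y k = ternaryDigit z k

/-- The reals which, for almost all `n`, do not agree with `b n` on the block `[n, g n)`. -/
def mismatchSet (b : ℕ → ℝ) (g : ℕ → ℕ) : Set ℝ :=
  {y | ∀ᶠ n in atTop, ¬ DigitsAgree y (b n) n (g n)}

theorem ternaryDigit_mem (y : ℝ) (k : ℕ) : 0 ≤ ternaryDigit y k ∧ ternaryDigit y k ≤ 2 := by
  have h1 := Int.floor_le ((3 : ℝ) ^ k * y)
  have h2 := Int.lt_floor_add_one ((3 : ℝ) ^ k * y)
  have e : (3 : ℝ) ^ (k + 1) * y = 3 * (3 ^ k * y) := by ring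
  have h3 : 3 * ⌊(3 : ℝ) ^ k * y⌋ ≤ ⌊(3 : ℝ) ^ (k + 1) * y⌋ := by
    rw [Int.le_floor, e]; push_cast; linarith
  have h4 : ⌊(3 : ℝ) ^ (k + 1) * y⌋ < 3 * ⌊(3 : ℝ) ^ k * y⌋ + 3 := by
    rw [Int.floor_lt, e]; push_cast; linarith
  unfold ternaryDigit
  omega

theorem floor_succ_eq (y : ℝ) (k : ℕ) :
    ⌊(3 : ℝ) ^ (k + 1) * y⌋ = 3 * ⌊(3 : ℝ) ^ k * y⌋ + ternaryDigit y k := by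
  unfold ternaryDigit; ring

theorem DigitsAgree.mono {y z : ℝ} {n m n' m' : ℕ} (h : DigitsAgree y z n m)
    (hn : n ≤ n') (hm : m' ≤ m) : DigitsAgree y z n' m' :=
  fun k hk hk' => h k (hn.trans hk) (hk'.trans_le hm)

theorem DigitsAgree.trans {x y z : ℝ} {n m : ℕ} (h : DigitsAgree x y n m)
    (h' : DigitsAgree y z n m) : DigitsAgree x z n m :=
  fun k hk hk' => (h k hk hk').trans (h' k hk hk')

theorem floor_eq_of_le {y z : ℝ} {n m : ℕ} (hnm : n ≤ m)
    (h : ⌊(3 : ℝ) ^ m * y⌋ = ⌊(3 : ℝ) ^ m * z⌋) : ⌊(3 : ℝ) ^ n * y⌋ = ⌊(3 : ℝ) ^ n * z⌋ := by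
  induction m, hnm using Nat.le_induction with
  | base => exact h
  | succ m _ ih =>
    apply ih
    rw [floor_succ_eq, floor_succ_eq] at h
    have := ternaryDigit_mem y m
    have := ternaryDigit_mem z m
    omega

theorem digitsAgree_of_floor_eq {y z : ℝ} {n m : ℕ}
    (h : ⌊(3 : ℝ) ^ m * y⌋ = ⌊(3 : ℝ) ^ m * z⌋) : DigitsAgree y z n m := by
  intro k _ hk
  unfold ternaryDigit
  rw [floor_eq_of_le hk h, floor_eq_of_le hk.le h]

theorem DigitsAgree.floor_eq {y z : ℝ} {n m : ℕ} (hnm : n ≤ m) (h : DigitsAgree y z n m)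
    (h0 : ⌊(3 : ℝ) ^ n * y⌋ = ⌊(3 : ℝ) ^ n * z⌋) : ⌊(3 : ℝ) ^ m * y⌋ = ⌊(3 : ℝ) ^ m * z⌋ := by
  induction m, hnm using Nat.le_induction with
  | base => exact h0
  | succ m hm ih =>
    rw [floor_succ_eq, floor_succ_eq, ih (h.mono le_rfl m.le_succ), h m hm m.lt_succ_self]

theorem exists_floor_eq_and_digitsAgree (z : ℝ) (n : ℕ) (j : ℤ) :
    ∃ w : ℝ, ⌊(3 : ℝ) ^ n * w⌋ = j ∧ ∀ m, DigitsAgree w z n m := by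
  have key : ∀ k, n ≤ k → ⌊(3 : ℝ) ^ k * (z + ((j - ⌊(3 : ℝ) ^ n * z⌋ : ℤ) : ℝ) / 3 ^ n)⌋ =
      ⌊(3 : ℝ) ^ k * z⌋ + 3 ^ (k - n) * (j - ⌊(3 : ℝ) ^ n * z⌋) := by
    intro k hk
    rw [← Int.floor_add_intCast]
    congr 1
    obtain ⟨l, rfl⟩ := Nat.exists_eq_add_of_le hk
    rw [Nat.add_sub_cancel_left]
    push_cast
    field_simp
    ring
  refine ⟨z + ((j - ⌊(3 : ℝ) ^ n * z⌋ : ℤ) : ℝ) / 3 ^ n, ?_, ?_⟩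
  · rw [key n le_rfl]; simp
  · intro m k hk _
    unfold ternaryDigit
    rw [key k hk, key (k + 1) (by omega), Nat.succ_sub hk, pow_succ 3 (k - n)]
    ring

theorem exists_open_floor_eq (w : ℝ) (m : ℕ) :
    ∃ U : Set ℝ, IsOpen U ∧ U.Nonempty ∧
      ∀ y ∈ U, ⌊(3 : ℝ) ^ m * y⌋ = ⌊(3 : ℝ) ^ m * w⌋ := by
  have hp : (0 : ℝ) < 3 ^ m := by positivity
  refine ⟨Ioo (⌊(3 : ℝ) ^ m * w⌋ / 3 ^ m) ((⌊(3 : ℝ) ^ m * w⌋ + 1) / 3 ^ m), isOpen_Ioo,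
    nonempty_Ioo.2 (by gcongr; linarith), fun y hy => ?_⟩
  have h1 := (div_lt_iff₀' hp).1 hy.1
  have h2 := (lt_div_iff₀' hp).1 hy.2
  exact Int.floor_eq_iff.2 ⟨h1.le, h2⟩

theorem dist_lt_of_floor_eq {y z r : ℝ} {n : ℕ} (hn : (1 / 3 : ℝ) ^ n < r)
    (h : ⌊(3 : ℝ) ^ n * y⌋ = ⌊(3 : ℝ) ^ n * z⌋) : dist y z < r := by
  have h1 := Int.abs_sub_lt_one_of_floor_eq_floor h
  have hp : (0 : ℝ) < 3 ^ n := by positivity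
  rw [← mul_sub, abs_mul, abs_of_pos hp, ← lt_div_iff₀' hp] at h1
  rw [one_div_pow] at hn
  exact h1.trans hn

theorem exists_pow_lt_of_ge {r : ℝ} (hr : 0 < r) (N : ℕ) : ∃ n ≥ N, (1 / 3 : ℝ) ^ n < r := by
  obtain ⟨n, hn⟩ := exists_pow_lt_of_lt_one hr (by norm_num : (1 / 3 : ℝ) < 1)
  exact ⟨max N n, le_max_left _ _,
    (pow_le_pow_of_le_one (by norm_num) (by norm_num) (le_max_right _ _)).trans_lt hn⟩

theorem isMeagre_mismatchSet (b : ℕ → ℝ) (g : ℕ → ℕ) : IsMeagre (mismatchSet b g) := by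
  have hW : ∀ N, (⋃ n ≥ N, interior {y | DigitsAgree y (b n) n (g n)}) ∈ residual ℝ := by
    intro N
    apply residual_of_dense_open
    · exact isOpen_biUnion fun _ _ => isOpen_interior
    · rw [Metric.dense_iff]
      intro x r hr
      obtain ⟨n, hn, hnr⟩ := exists_pow_lt_of_ge hr N
      obtain ⟨w, hw, hwb⟩ := exists_floor_eq_and_digitsAgree (b n) n ⌊(3 : ℝ) ^ n * x⌋
      obtain ⟨U, hU, ⟨c, hc⟩, hUw⟩ := exists_open_floor_eq w (max n (g n))
      refine ⟨c, ?_, mem_biUnion hn ?_⟩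
      · exact dist_lt_of_floor_eq hnr ((floor_eq_of_le (le_max_left _ _) (hUw c hc)).trans hw)
      · refine mem_interior.2 ⟨U, fun y hy => ?_, hU, hc⟩
        exact ((digitsAgree_of_floor_eq (hUw y hy)).mono le_rfl (le_max_right _ _)).trans (hwb _)
  refine mem_of_superset (countable_iInter_mem.2 hW) fun y hy hy' => ?_
  obtain ⟨N, hN⟩ := eventually_atTop.1 hy'
  obtain ⟨n, hn, hyn⟩ := mem_iUnion₂.1 (mem_iInter.1 hy N)
  exact hN n hn (interior_subset hyn)

theorem exists_block_subset {V : Set ℝ} (hV : IsOpen V) (hd : Dense V) (n : ℕ) (F : Finset ℤ) :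
    ∃ (b : ℝ) (m : ℕ), n ≤ m ∧
      ∀ y : ℝ, ⌊(3 : ℝ) ^ n * y⌋ ∈ F → DigitsAgree y b n m → y ∈ V := by
  induction F using Finset.induction_on with
  | empty => exact ⟨0, n, le_rfl, by simp⟩
  | insert j F _ ih =>
    obtain ⟨b, m, hnm, hb⟩ := ih
    obtain ⟨w, hw, hwb⟩ := exists_floor_eq_and_digitsAgree b n j
    obtain ⟨U, hU, hne, hUw⟩ := exists_open_floor_eq w m
    obtain ⟨y₀, hyU, hyV⟩ := hd.inter_open_nonempty U hU hne
    obtain ⟨r, hr, hball⟩ := Metric.isOpen_iff.1 hV y₀ hyV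
    obtain ⟨m', hm', hmr⟩ := exists_pow_lt_of_ge hr m
    refine ⟨y₀, m', hnm.trans hm', fun y hy hag => ?_⟩
    rcases Finset.mem_insert.1 hy with h | h
    · refine hball (dist_lt_of_floor_eq hmr (hag.floor_eq (hnm.trans hm') ?_))
      rw [h, floor_eq_of_le hnm (hUw y₀ hyU), hw]
    · exact hb y h (((hag.mono le_rfl hm').trans
        (digitsAgree_of_floor_eq (hUw y₀ hyU))).trans (hwb m))

theorem IsMeagre.exists_subset_mismatchSet {E : Set ℝ} (hE : IsMeagre E) :
    ∃ b g, E ⊆ mismatchSet b g := by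
  obtain ⟨S, hSo, hSd, hSc, hSE⟩ := mem_residual_iff.1 hE
  obtain ⟨D, hD⟩ := (hSc.insert Set.univ).exists_eq_range (insert_nonempty _ _)
  have hDo : ∀ i, IsOpen (D i) := fun i => by
    rcases (hD ▸ mem_range_self i : D i ∈ insert Set.univ S) with h | h
    · rw [h]; exact isOpen_univ
    · exact hSo _ h
  have hDd : ∀ i, Dense (D i) := fun i => by
    rcases (hD ▸ mem_range_self i : D i ∈ insert Set.univ S) with h | h
    · rw [h]; exact dense_univ
    · exact hSd _ h
  have hstep : ∀ n : ℕ, ∃ (b : ℝ) (m : ℕ), n ≤ m ∧ ∀ y : ℝ,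
      ⌊(3 : ℝ) ^ n * y⌋ ∈ Finset.Icc (-(3 ^ n * n : ℤ)) (3 ^ n * n) →
      DigitsAgree y b n m → y ∈ ⋂ i ∈ Iic n, D i := fun n =>
    exists_block_subset ((finite_Iic n).isOpen_biInter fun i _ => hDo i)
      (dense_biInter_of_isOpen (fun i _ => hDo i) (to_countable _) fun i _ => hDd i) n _
  choose b g _ hbg using hstep
  refine ⟨b, g, fun y hy => ?_⟩
  by_contra hcon
  have hfr : ∃ᶠ n in atTop, DigitsAgree y (b n) n (g n) := hcon
  refine hSE (fun t ht => ?_) hy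
  obtain ⟨i, rfl⟩ : t ∈ range D := hD ▸ mem_insert_of_mem _ ht
  obtain ⟨N, hN⟩ := exists_nat_ge |y|
  obtain ⟨n, hn, hag⟩ := frequently_atTop.1 hfr (max i N)
  refine mem_iInter₂.1 (hbg n y (Finset.mem_Icc.2 ?_) hag) i ((le_max_left _ _).trans hn)
  have hyn : |y| ≤ n := hN.trans (by exact_mod_cast (le_max_right _ _).trans hn)
  obtain ⟨h1, h2⟩ := abs_le.1 hyn
  have hp : (0 : ℝ) < 3 ^ n := by positivity
  constructor
  · rw [Int.le_floor]
    push_cast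
    nlinarith
  · have := Int.floor_le ((3 : ℝ) ^ n * y)
    have h3 : (⌊(3 : ℝ) ^ n * y⌋ : ℝ) ≤ 3 ^ n * n := by nlinarith
    exact_mod_cast h3

theorem exists_mismatchSet_subset {Z : Set ℝ} (hZ : ¬ IsMeagre Z) {D : Set (ℕ → ℕ)}
    (hD : ∀ f : ℕ → ℕ, ∃ g ∈ D, ∀ᶠ n in atTop, f n ≤ g n) (b : ℕ → ℝ) (f : ℕ → ℕ) :
    ∃ z ∈ Z, ∃ g ∈ D, mismatchSet b f ⊆ mismatchSet (fun _ => z) g := by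
  obtain ⟨z, hz, hzb⟩ := not_subset.1 fun h => hZ ((isMeagre_mismatchSet b f).mono h)
  have hfr : ∃ᶠ n in atTop, DigitsAgree z (b n) n (f n) := hzb
  choose next hle hag using frequently_atTop.1 hfr
  obtain ⟨g, hg, hdom⟩ := hD fun m => f (next m)
  refine ⟨z, hz, g, hg, fun y hy => ?_⟩
  obtain ⟨N, hN⟩ := eventually_atTop.1 hy
  filter_upwards [hdom, eventually_ge_atTop N] with m hm hNm hyz
  exact hN (next m) (hNm.trans (hle m)) ((hyz.mono (hle m) hm).trans (hag m))

theorem exists_real_with_ternaryDigit {d : ℕ → ℤ} (h0 : ∀ k, 0 ≤ d k) (h2 : ∀ k, d k ≤ 2)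
    (hd : ∃ᶠ k in atTop, d k ≠ 2) : ∃ y : ℝ, ∀ k, ternaryDigit y k = d k := by
  obtain ⟨S, hS⟩ : ∃ S : ℕ → ℤ, ∀ k, S (k + 1) = 3 * S k + d k :=
    ⟨fun n => Nat.rec (motive := fun _ => ℤ) 0 (fun k s => 3 * s + d k) n, fun _ => rfl⟩
  have hSr : ∀ k, (S (k + 1) : ℝ) = 3 * S k + d k := fun k => by exact_mod_cast hS k
  have hp : ∀ k : ℕ, (0 : ℝ) < 3 ^ k := fun k => by positivity
  have hlow : Monotone fun n => (S n : ℝ) / 3 ^ n := by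
    refine monotone_nat_of_le_succ fun k => ?_
    have : (0 : ℝ) ≤ d k := by exact_mod_cast h0 k
    rw [div_le_div_iff₀ (hp _) (hp _), hSr, pow_succ]
    nlinarith [hp k]
  have hup : Antitone fun n => ((S n : ℝ) + 1) / 3 ^ n := by
    refine antitone_nat_of_succ_le fun k => ?_
    have : (d k : ℝ) ≤ 2 := by exact_mod_cast h2 k
    rw [div_le_div_iff₀ (hp _) (hp _), hSr, pow_succ]
    nlinarith [hp k]
  have hlu : ∀ n m, (S n : ℝ) / 3 ^ n ≤ ((S m : ℝ) + 1) / 3 ^ m := fun n m =>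
    calc (S n : ℝ) / 3 ^ n ≤ (S (max n m) : ℝ) / 3 ^ max n m := hlow (le_max_left _ _)
      _ ≤ ((S (max n m) : ℝ) + 1) / 3 ^ max n m := by gcongr; linarith
      _ ≤ _ := hup (le_max_right _ _)
  have hfloor : ∀ n, ⌊(3 : ℝ) ^ n * ⨆ n, (S n : ℝ) / 3 ^ n⌋ = S n := by
    intro n
    rw [Int.floor_eq_iff, ← div_le_iff₀' (hp n), ← lt_div_iff₀' (hp n)]
    refine ⟨le_ciSup (f := fun n => (S n : ℝ) / 3 ^ n) ⟨_, forall_mem_range.2 fun k => hlu k 0⟩ n,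
      ?_⟩
    obtain ⟨k, hk, hdk⟩ := frequently_atTop.1 hd n
    refine (ciSup_le fun i => hlu i (k + 1)).trans_lt (lt_of_lt_of_le ?_ (hup hk))
    have : (d k : ℝ) ≤ 1 := by
      have := h2 k
      exact_mod_cast (by omega : d k ≤ 1)
    rw [div_lt_div_iff₀ (hp _) (hp _), hSr, pow_succ]
    nlinarith [hp k]
  refine ⟨⨆ n, (S n : ℝ) / 3 ^ n, fun k => ?_⟩
  unfold ternaryDigit
  rw [hfloor, hfloor, hS]
  ring

theorem ternaryDigit_zero (k : ℕ) : ternaryDigit 0 k = 0 := by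
  simp [ternaryDigit]

theorem eventually_le_of_mismatchSet_subset {f : ℕ → ℕ} (hf : Monotone f) (hlt : ∀ n, n < f n)
    {b : ℕ → ℝ} {g : ℕ → ℕ} (h : mismatchSet (fun _ => 0) f ⊆ mismatchSet b g) :
    ∀ᶠ n in atTop, f n ≤ g n := by
  by_contra hcon
  have hfr : ∃ᶠ n in atTop, g n < f n := by simpa [Filter.Frequently] using hcon
  choose next hle hnext using frequently_atTop.1 hfr
  obtain ⟨s, hs0, hs'⟩ : ∃ s : ℕ → ℕ, s 0 = next 0 ∧ ∀ k, s (k + 1) = next (f (s k) + 1) :=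
    ⟨fun k => Nat.rec (motive := fun _ => ℕ) (next 0) (fun _ n => next (f n + 1)) k,
      rfl, fun _ => rfl⟩
  have hs : ∀ k, f (s k) < s (k + 1) := fun k => hs' k ▸ hle (f (s k) + 1)
  have hgs : ∀ k, g (s k) < f (s k) := fun k => by
    cases k with
    | zero => exact hs0 ▸ hnext 0
    | succ k => exact hs' k ▸ hnext _
  have hmono : StrictMono s := strictMono_nat_of_lt_succ fun k => (hlt _).trans (hs k)
  have hlate : ∀ {i j}, i < j → f (s i) < s j := fun {i j} hij =>
    (hs i).trans_le (hmono.monotone hij)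
  have huniq : ∀ {i j p}, s i ≤ p → p < f (s i) → s j ≤ p → p < f (s j) → i = j := by
    intro i j p hi hi' hj hj'
    rcases lt_trichotomy i j with hij | hij | hij
    · have := hlate hij; omega
    · exact hij
    · have := hlate hij; omega
  classical
  let d : ℕ → ℤ := fun p =>
    if hp : ∃ k, s k ≤ p ∧ p < g (s k) then ternaryDigit (b (s hp.choose)) p else 1
  have hd_in : ∀ k p, s k ≤ p → p < g (s k) → d p = ternaryDigit (b (s k)) p := by
    intro k p h1 h2
    have hp : ∃ k, s k ≤ p ∧ p < g (s k) := ⟨k, h1, h2⟩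
    have := huniq hp.choose_spec.1 (hp.choose_spec.2.trans (hgs _)) h1 (h2.trans (hgs _))
    simp only [d, dif_pos hp, this]
  have hd_out : ∀ p, (¬ ∃ k, s k ≤ p ∧ p < g (s k)) → d p = 1 := fun p hp => dif_neg hp
  have hd_end : ∀ k, s k ≤ g (s k) → d (g (s k)) = 1 := by
    intro k hk
    refine hd_out _ ?_
    rintro ⟨j, h1, h2⟩
    obtain rfl := huniq h1 (h2.trans (hgs j)) hk (hgs k)
    exact lt_irrefl _ h2
  have hmeet : ∀ m, ∃ p, m ≤ p ∧ p < f m ∧ d p = 1 := by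
    intro m
    by_cases hm : ∃ k, s k ≤ m ∧ m < g (s k)
    · obtain ⟨k, h1, h2⟩ := hm
      exact ⟨g (s k), h2.le, (hgs k).trans_le (hf h1), hd_end k (h1.trans h2.le)⟩
    · exact ⟨m, le_rfl, hlt m, hd_out m hm⟩
  have hrange : ∀ p, 0 ≤ d p ∧ d p ≤ 2 := by
    intro p
    by_cases hp : ∃ k, s k ≤ p ∧ p < g (s k)
    · simp only [d, dif_pos hp]; exact ternaryDigit_mem _ _
    · rw [hd_out p hp]; norm_num
  obtain ⟨y, hy⟩ := exists_real_with_ternaryDigit (fun p => (hrange p).1) (fun p => (hrange p).2)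
    (frequently_atTop.2 fun m => by
      obtain ⟨p, hp, -, h1⟩ := hmeet m
      exact ⟨p, hp, by rw [h1]; norm_num⟩)
  have hyf : y ∈ mismatchSet (fun _ => 0) f := by
    refine Eventually.of_forall fun m hag => ?_
    obtain ⟨p, hp, hp', h1⟩ := hmeet m
    have := hag p hp hp'
    rw [hy, h1, ternaryDigit_zero] at this
    exact one_ne_zero this
  obtain ⟨N, hN⟩ := eventually_atTop.1 (h hyf)
  refine hN (s N) (hmono.le_apply) fun p hp hp' => ?_
  rw [hy, hd_in N p hp hp']

theorem not_isMeagre_univ_real : ¬ IsMeagre (Set.univ : Set ℝ) :=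
  not_isMeagre_of_isOpen isOpen_univ univ_nonempty

theorem exists_cofMeager_family : ∃ 𝒜 : Set (Set ℝ), (∀ A ∈ 𝒜, IsMeagre A) ∧
    (∀ B : Set ℝ, IsMeagre B → ∃ A ∈ 𝒜, B ⊆ A) ∧ #𝒜 = cofMeager :=
  csInf_mem (s := {c | ∃ 𝒜 : Set (Set ℝ), (∀ A ∈ 𝒜, IsMeagre A) ∧
    (∀ B : Set ℝ, IsMeagre B → ∃ A ∈ 𝒜, B ⊆ A) ∧ #𝒜 = c})
    ⟨_, {A | IsMeagre A}, fun _ h => h, fun B hB => ⟨B, hB, Subset.rfl⟩, rfl⟩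

theorem exists_nonMeager_set : ∃ A : Set ℝ, ¬ IsMeagre A ∧ #A = nonMeager :=
  csInf_mem (s := {c | ∃ A : Set ℝ, ¬ IsMeagre A ∧ #A = c})
    ⟨_, Set.univ, not_isMeagre_univ_real, rfl⟩

theorem exists_dominating_family : ∃ D : Set (ℕ → ℕ), #D = dominatingNumber ∧
    ∀ f : ℕ → ℕ, ∃ g ∈ D, ∀ᶠ n in atTop, f n ≤ g n :=
  csInf_mem (s := {c | ∃ D : Set (ℕ → ℕ), #D = c ∧
    ∀ f : ℕ → ℕ, ∃ g ∈ D, ∀ᶠ n in atTop, f n ≤ g n})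
    ⟨_, Set.univ, rfl, fun f => ⟨f, mem_univ f, Eventually.of_forall fun _ => le_rfl⟩⟩

theorem aleph0_le_nonMeager : ℵ₀ ≤ nonMeager := by
  obtain ⟨A, hA, hcard⟩ := exists_nonMeager_set
  rw [← hcard]
  by_contra! hlt
  refine hA ?_
  have hc : A.Countable := Cardinal.le_aleph0_iff_set_countable.1 hlt.le
  rw [← biUnion_of_singleton A]
  exact isMeagre_biUnion hc fun x _ => (isClosed_singleton.isNowhereDense_iff.2
    (interior_singleton x)).isMeagre

theorem nonMeager_le_cofMeager : nonMeager ≤ cofMeager := by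
  obtain ⟨𝒜, hm, hcof, hcard⟩ := exists_cofMeager_family
  have hex : ∀ A : 𝒜, ∃ x : ℝ, x ∉ (A : Set ℝ) := fun A => by
    by_contra! h
    exact not_isMeagre_univ_real ((eq_univ_of_forall h) ▸ hm A A.2)
  choose x hx using hex
  rw [← hcard]
  refine le_trans (csInf_le' ⟨range x, fun hr => ?_, rfl⟩) mk_range_le
  obtain ⟨A, hA, hsub⟩ := hcof _ hr
  exact hx ⟨A, hA⟩ (hsub (mem_range_self _))

theorem dominatingNumber_le_cofMeager : dominatingNumber ≤ cofMeager := by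
  obtain ⟨𝒜, hm, hcof, hcard⟩ := exists_cofMeager_family
  choose b g hbg using fun A : 𝒜 => (hm A A.2).exists_subset_mismatchSet
  rw [← hcard]
  refine le_trans (csInf_le' ⟨range g, rfl, fun f => ?_⟩) mk_range_le
  let f' : ℕ → ℕ := fun n => n + 1 + ∑ k ∈ Finset.range (n + 1), f k
  have hmono : Monotone f' := fun m n hmn => by
    have := Finset.sum_le_sum_of_subset (f := f) (Finset.range_mono (Nat.add_le_add_right hmn 1))
    simp only [f']
    omega
  obtain ⟨A, hA, hsub⟩ := hcof _ (isMeagre_mismatchSet (fun _ => 0) f')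
  refine ⟨g ⟨A, hA⟩, mem_range_self _, ?_⟩
  filter_upwards [eventually_le_of_mismatchSet_subset hmono (fun n => by simp only [f']; omega)
    (hsub.trans (hbg ⟨A, hA⟩))] with n hn
  refine le_trans ?_ hn
  have := Finset.single_le_sum (f := f) (fun _ _ => Nat.zero_le _) (Finset.self_mem_range_succ n)
  simp only [f']
  omega

theorem cofMeager_le_max : cofMeager ≤ max dominatingNumber nonMeager := by
  obtain ⟨Z, hZ, hZcard⟩ := exists_nonMeager_set
  obtain ⟨D, hDcard, hD⟩ := exists_dominating_family
  calc cofMeager ≤ #(range fun p : D × Z => mismatchSet (fun _ => (p.2 : ℝ)) p.1) := by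
        refine csInf_le' ⟨_, ?_, fun B hB => ?_, rfl⟩
        · rintro _ ⟨p, rfl⟩
          exact isMeagre_mismatchSet _ _
        · obtain ⟨b, f, hbf⟩ := hB.exists_subset_mismatchSet
          obtain ⟨z, hz, g, hg, hsub⟩ := exists_mismatchSet_subset hZ hD b f
          exact ⟨_, ⟨(⟨g, hg⟩, ⟨z, hz⟩), rfl⟩, hbf.trans hsub⟩
    _ ≤ #(D × Z) := mk_range_le
    _ = dominatingNumber * nonMeager := by rw [mk_prod, lift_id, lift_id, hDcard, hZcard]
    _ ≤ max dominatingNumber nonMeager := mul_le_max_of_aleph0_le_right aleph0_le_nonMeager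

/-- `cof(M) = max {𝔡, non(M)}`. -/
theorem cofMeager_eq_max : cofMeager = max dominatingNumber nonMeager := by
  exact le_antisymm cofMeager_le_max (max_le dominatingNumber_le_cofMeager nonMeager_le_cofMeager)
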